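/- Let k ≥ 2 be an integer and ν an even integer with 2k+2 ≤ ν ≤ 4k−2. Then every k-extendable non-bipartite finite simple graph on ν vertices has at least (2k+1)ν/2 edges, and there exists a k-extendable non-bipartite finite simple graph on ν vertices with exactly (2k+1)ν/2 edges. Hence ε(ν,k) = (2k+1)ν/2 for even ν with 2k+2 ≤ ν ≤ 4k−2. -/

import Mathlib

open SimpleGraph

/-- `G` is `n`-factor-critical if for every set `S` of exactly `n` vertices,
the graph obtained by deleting `S` has a perfect matching; formalized as:
there is a matching of `G` whose vertex set is exactly the complement of `S`. -/
def IsFactorCritical {V : Type*} (G : SimpleGraph V) (n : ℕ) : Prop :=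
  ∀ S : Finset V, S.card = n →
    ∃ M : G.Subgraph, M.IsMatching ∧ M.verts = (↑S : Set V)ᶜ

/-- `G` is `k`-extendable if it is connected, has a matching with `k` edges,
and every matching with `k` edges is contained in a perfect matching. -/
def IsExtendable {V : Type*} (G : SimpleGraph V) (k : ℕ) : Prop :=
  G.Connected ∧
  (∃ M : G.Subgraph, M.IsMatching ∧ M.edgeSet.ncard = k) ∧
  ∀ M : G.Subgraph, M.IsMatching → M.edgeSet.ncard = k →
    ∃ P : G.Subgraph, P.IsPerfectMatching ∧ M ≤ P

namespace SimpleGraph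

section Matchable

variable {V : Type*} {G : SimpleGraph V}

/-- `s` is the vertex set of a matching of `G`. -/
def IsMatchable (G : SimpleGraph V) (s : Finset V) : Prop :=
  ∃ f : V → V, ∀ x ∈ s, f x ∈ s ∧ f (f x) = x ∧ G.Adj x (f x)

lemma isMatchable_empty : G.IsMatchable ∅ := ⟨id, by simp⟩

lemma IsMatchable.subset_of_closed {s t : Finset V} (h : G.IsMatchable t) (hst : s ⊆ t)
    (hs : ∀ x ∈ s, ∀ y ∈ t, y ∉ s → ¬ G.Adj x y) : G.IsMatchable s := by
  obtain ⟨f, hf⟩ := h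
  refine ⟨f, fun x hx => ⟨?_, (hf x (hst hx)).2⟩⟩
  by_contra hfx
  exact hs x hx _ (hf x (hst hx)).1 hfx (hf x (hst hx)).2.2

variable [DecidableEq V]

lemma isMatchable_pair {u v : V} (h : G.Adj u v) : G.IsMatchable {u, v} := by
  refine ⟨Equiv.swap u v, fun x hx => ?_⟩
  rw [Finset.mem_insert, Finset.mem_singleton] at hx
  rcases hx with rfl | rfl <;> simp [h, h.symm]

lemma IsMatchable.union {s t : Finset V} (hs : G.IsMatchable s) (ht : G.IsMatchable t)
    (hd : Disjoint s t) : G.IsMatchable (s ∪ t) := by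
  obtain ⟨f, hf⟩ := hs
  obtain ⟨g, hg⟩ := ht
  refine ⟨fun x => if x ∈ s then f x else g x, fun x hx => ?_⟩
  by_cases hxs : x ∈ s
  · have := hf x hxs
    simp [hxs, this]
  · have hxt : x ∈ t := by simpa [hxs] using hx
    have := hg x hxt
    have h2 : g x ∉ s := fun h => Finset.disjoint_left.1 hd h this.1
    simp [hxs, h2, this]

lemma IsMatchable.insert_pair {s : Finset V} {u v : V} (hs : G.IsMatchable s) (h : G.Adj u v)
    (hu : u ∉ s) (hv : v ∉ s) : G.IsMatchable (insert u (insert v s)) := by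
  have := (isMatchable_pair h).union hs (by simp [hu, hv])
  simpa [Finset.insert_union] using this

lemma IsMatchable.exists_partner {s : Finset V} {x : V} (hs : G.IsMatchable s) (hx : x ∈ s) :
    ∃ y ∈ s, G.Adj x y ∧ G.IsMatchable ((s.erase x).erase y) := by
  obtain ⟨f, hf⟩ := hs
  refine ⟨f x, (hf x hx).1, (hf x hx).2.2, f, fun z hz => ?_⟩
  simp only [Finset.mem_erase] at hz ⊢
  obtain ⟨h1, h2, h3⟩ := hz
  refine ⟨⟨fun h => h2 ?_, fun h => h1 ?_, (hf z h3).1⟩, (hf z h3).2⟩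
  · rw [← (hf z h3).2.1, h, (hf x hx).2.1]
  · rw [← (hf z h3).2.1, h]

lemma card_erase_erase_add_two {s : Finset V} {x y : V} (hx : x ∈ s) (hy : y ∈ s) (h : x ≠ y) :
    ((s.erase x).erase y).card + 2 = s.card := by
  have h1 := Finset.card_erase_add_one hx
  have h2 := Finset.card_erase_add_one (Finset.mem_erase.2 ⟨h.symm, hy⟩)
  omega

lemma IsMatchable.even_card {s : Finset V} (hs : G.IsMatchable s) : Even s.card := by
  induction hn : s.card using Nat.strong_induction_on generalizing s with
  | _ n ih =>
    rcases s.eq_empty_or_nonempty with rfl | ⟨x, hx⟩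
    · simp at hn; simp [← hn]
    · obtain ⟨y, hy, hxy, h⟩ := hs.exists_partner hx
      have hc := card_erase_erase_add_two hx hy hxy.ne
      have := ih _ (by omega) h rfl
      rw [← hn, ← hc]
      exact this.add even_two

/-- The exchange property of vertex sets of matchings. -/
lemma IsMatchable.exchange {s t : Finset V} (hs : G.IsMatchable s) (ht : G.IsMatchable t)
    {x : V} (hxs : x ∈ s) (hxt : x ∉ t) :
    (∃ y ∈ s, y ∉ t ∧ y ≠ x ∧ G.IsMatchable (insert x (insert y t))) ∨
      ∃ y ∈ t, y ∉ s ∧ G.IsMatchable (insert x (t.erase y)) := by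
  induction hn : s.card using Nat.strong_induction_on generalizing s t x with
  | _ n ih =>
    obtain ⟨w, hws, hxw, hs'⟩ := hs.exists_partner hxs
    by_cases hwt : w ∈ t
    swap
    · exact .inl ⟨w, hws, hwt, hxw.ne', ht.insert_pair hxw hxt hwt⟩
    obtain ⟨z, hzt, hwz, ht'⟩ := ht.exists_partner hwt
    have hxz : x ≠ z := fun h => hxt (h ▸ hzt)
    by_cases hzs : z ∈ s
    swap
    · refine .inr ⟨z, hzt, hzs, ?_⟩
      convert ht'.insert_pair hxw (by simp [hxt]) (by simp) using 1
      ext a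
      simp only [Finset.mem_insert, Finset.mem_erase]
      grind
    have hc := card_erase_erase_add_two hxs hws hxw.ne
    have hz := ih _ (by omega) hs' ht' (x := z) (by simp [hwz.ne', hxz.symm, hzs]) (by simp) rfl
    clear ih
    rcases hz with ⟨y, hy, hyt, hyz, h⟩ | ⟨y, hy, hys, h⟩
    · simp only [Finset.mem_erase] at hy hyt
      have hyt' : y ∉ t := fun h' => hyt ⟨hyz, hy.1, h'⟩
      refine .inl ⟨y, hy.2.2, hyt', hy.2.1, ?_⟩
      convert h.insert_pair hxw (by simp [hxz, hy.2.1.symm, hxt])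
        (by simp [hwz.ne, hy.1.symm]) using 1
      ext a
      simp only [Finset.mem_insert, Finset.mem_erase]
      grind only
    · simp only [Finset.mem_erase] at hy hys
      have hyx : y ≠ x := fun h => hxt (h ▸ hy.2.2)
      refine .inr ⟨y, hy.2.2, fun h' => hys ⟨hy.2.1, hyx, h'⟩, ?_⟩
      convert h.insert_pair hxw (by simp [hxz, hxt]) (by simp [hwz.ne]) using 1
      ext a
      simp only [Finset.mem_insert, Finset.mem_erase]
      grind only

/-- A matching meets an independent set in at most half of its vertices. -/
lemma IsMatchable.exists_of_indep {t I : Finset V} (ht : G.IsMatchable t) (hI : I ⊆ t)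
    (hind : ∀ x ∈ I, ∀ y ∈ I, ¬ G.Adj x y) :
    ∃ s ⊆ t \ I, G.IsMatchable s ∧ s.card + 2 * I.card = t.card := by
  obtain ⟨f, hf⟩ := ht
  have hinj : Set.InjOn f I := fun a ha b hb hab => by
    rw [← (hf a (hI ha)).2.1, hab, (hf b (hI hb)).2.1]
  have hdis : Disjoint I (I.image f) := by
    rw [Finset.disjoint_right]
    intro a ha haI
    obtain ⟨b, hb, rfl⟩ := Finset.mem_image.1 ha
    exact hind b hb _ haI (hf b (hI hb)).2.2
  have hsub : I ∪ I.image f ⊆ t := by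
    intro a ha
    rcases Finset.mem_union.1 ha with h | h
    · exact hI h
    · obtain ⟨b, hb, rfl⟩ := Finset.mem_image.1 h
      exact (hf b (hI hb)).1
  refine ⟨t \ (I ∪ I.image f), ?_, ⟨f, fun x hx => ?_⟩, ?_⟩
  · exact Finset.sdiff_subset_sdiff le_rfl Finset.subset_union_left
  · simp only [Finset.mem_sdiff, Finset.mem_union, Finset.mem_image, not_or, not_exists,
      not_and] at hx ⊢
    have h := hf x hx.1
    refine ⟨⟨h.1, fun hI' => hx.2.2 _ hI' h.2.1, fun y hy hyx => hx.2.1 ?_⟩, h.2⟩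
    rw [← h.2.1, ← hyx, (hf y (hI hy)).2.1]
    exact hy
  · have h1 := Finset.card_sdiff_add_card_eq_card hsub
    rw [Finset.card_union_of_disjoint hdis, Finset.card_image_of_injOn hinj] at h1
    omega

lemma IsMatchable.two_mul_card_indep_le {t I : Finset V} (ht : G.IsMatchable t) (hI : I ⊆ t)
    (hind : ∀ x ∈ I, ∀ y ∈ I, ¬ G.Adj x y) : 2 * I.card ≤ t.card := by
  obtain ⟨s, -, -, h⟩ := ht.exists_of_indep hI hind
  omega

/-- The easy direction of Tutte's theorem. -/
lemma IsMatchable.card_le_of_odd_closed {t B : Finset V} (ht : G.IsMatchable t)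
    (𝒞 : Finset (Finset V)) (hdis : ∀ C ∈ 𝒞, ∀ D ∈ 𝒞, ∀ x ∈ C, x ∈ D → C = D)
    (hodd : ∀ C ∈ 𝒞, Odd C.card) (hsub : ∀ C ∈ 𝒞, C ⊆ t)
    (hclosed : ∀ C ∈ 𝒞, ∀ x ∈ C, ∀ y ∈ t, G.Adj x y → y ∈ C ∨ y ∈ B) :
    𝒞.card ≤ B.card := by
  obtain ⟨f, hf⟩ := ht
  have key : ∀ C ∈ 𝒞, ∃ b ∈ B, f b ∈ C := by
    intro C hC
    by_contra! hcon
    have : G.IsMatchable C := by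
      refine ⟨f, fun x hx => ?_⟩
      have h := hf x (hsub C hC hx)
      refine ⟨?_, h.2⟩
      rcases hclosed C hC x hx _ h.1 h.2.2 with h' | h'
      · exact h'
      · exact absurd (by rw [h.2.1]; exact hx) (hcon _ h')
    exact Nat.not_even_iff_odd.2 (hodd C hC) this.even_card
  rcases 𝒞.eq_empty_or_nonempty with rfl | ⟨C₀, hC₀⟩
  · simp
  have : Nonempty V := ⟨(key C₀ hC₀).choose⟩
  choose! g hg using key
  refine Finset.card_le_card_of_injOn g (fun C hC => (hg C hC).1) ?_
  intro C hC D hD h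
  exact hdis C hC D hD _ (hg C hC).2 (by rw [h]; exact (hg D hD).2)

end Matchable

lemma IsMatchable.exists_isMatching {V : Type*} {G : SimpleGraph V} {s : Finset V}
    (hs : G.IsMatchable s) : ∃ M : G.Subgraph, M.IsMatching ∧ M.verts = s := by
  obtain ⟨f, hf⟩ := hs
  refine ⟨⟨s, fun x y => x ∈ s ∧ f x = y, ?_, fun h => h.1, ⟨?_⟩⟩, fun x hx => ?_, rfl⟩
  · rintro x _ ⟨hx, rfl⟩
    exact (hf x hx).2.2
  · rintro x _ ⟨hx, rfl⟩
    exact ⟨(hf x hx).1, (hf x hx).2.1⟩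
  · exact ⟨f x, ⟨hx, rfl⟩, fun y hy => hy.2.symm⟩

lemma Subgraph.IsMatching.isMatchable {V : Type*} {G : SimpleGraph V} {M : G.Subgraph}
    (hM : M.IsMatching) {s : Finset V} (hs : M.verts = s) : G.IsMatchable s := by
  classical
  choose! f hf using fun v (hv : v ∈ M.verts) => (hM hv).exists
  have key : ∀ x ∈ s, x ∈ M.verts := fun x hx => by rw [hs]; exact hx
  refine ⟨f, fun x hx => ?_⟩
  have h := hf x (key x hx)
  have hfx := M.edge_vert h.symm
  exact ⟨by rw [hs] at hfx; exact hfx, (hM hfx).unique (hf _ hfx) h.symm, M.adj_sub h⟩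

lemma Subgraph.IsMatching.ncard_verts {V : Type*} [Finite V] {G : SimpleGraph V} {M : G.Subgraph}
    (hM : M.IsMatching) : M.verts.ncard = 2 * M.edgeSet.ncard := by
  classical
  have := Fintype.ofFinite V
  have h := M.spanningCoe.sum_degrees_eq_twice_card_edges
  rw [← Set.ncard_coe_finset, coe_edgeFinset, edgeSet_spanningCoe] at h
  rw [← h, Set.ncard_eq_toFinset_card', Finset.card_eq_sum_ones, ← Finset.sum_subset
    (Finset.subset_univ M.verts.toFinset)]
  · refine Finset.sum_congr rfl fun x hx => ?_
    rw [Set.mem_toFinset] at hx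
    rw [degree_spanningCoe]
    exact (isMatching_iff_forall_degree.1 hM x hx).symm
  · intro x _ hx
    rw [Set.mem_toFinset] at hx
    rw [degree_spanningCoe, M.degree_of_notMem_verts hx]

/-- Tutte's theorem, with the barrier and the odd components as finite sets of vertices. -/
lemma exists_odd_closed_of_not_isMatchable_univ {W : Type*} [Fintype W] [DecidableEq W]
    {H : SimpleGraph W} (h : ¬ H.IsMatchable Finset.univ) (he : Even (Fintype.card W)) :
    ∃ (B : Finset W) (𝒞 : Finset (Finset W)),
      (∀ C ∈ 𝒞, ∀ D ∈ 𝒞, ∀ x ∈ C, x ∈ D → C = D) ∧ (∀ C ∈ 𝒞, Odd C.card) ∧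
      (∀ C ∈ 𝒞, ∀ x ∈ C, x ∉ B) ∧ (∀ C ∈ 𝒞, ∀ x ∈ C, ∀ y, H.Adj x y → y ∈ C ∨ y ∈ B) ∧
      B.card + 2 ≤ 𝒞.card := by
  classical
  have hT : ¬ ∃ M : H.Subgraph, M.IsPerfectMatching := by
    rintro ⟨M, hM⟩
    exact h (hM.1.isMatchable (by simpa using hM.2.verts_eq_univ))
  rw [tutte] at hT
  push Not at hT
  obtain ⟨u, hu⟩ := hT
  unfold IsTutteViolator at hu
  set K := ((⊤ : H.Subgraph).deleteVerts u).coe with hK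
  let φ : K.ConnectedComponent → Finset W := fun c => (Set.image Subtype.val c.supp).toFinset
  have hφ : ∀ c x, x ∈ φ c ↔ ∃ hx, (⟨x, hx⟩ : ((⊤ : H.Subgraph).deleteVerts u).verts) ∈ c.supp := by
    intro c x
    simp [φ]
  have hdis : ∀ c d x, x ∈ φ c → x ∈ φ d → c = d := by
    intro c d x hc hd
    obtain ⟨hx, hc⟩ := (hφ c x).1 hc
    obtain ⟨hx', hd⟩ := (hφ d x).1 hd
    exact ConnectedComponent.eq_of_common_vertex hc hd
  have hcard : ∀ c, (φ c).card = c.supp.ncard := by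
    intro c
    rw [← Set.ncard_image_of_injective c.supp Subtype.val_injective, Set.ncard_eq_toFinset_card']
  have hne : ∀ c, (φ c).Nonempty := by
    intro c
    obtain ⟨x, hx⟩ := c.nonempty_supp
    exact ⟨x, (hφ c x).2 ⟨x.2, hx⟩⟩
  refine ⟨u.toFinset, K.oddComponents.toFinset.image φ, ?_, ?_, ?_, ?_, ?_⟩
  · intro C hC D hD x hxC hxD
    obtain ⟨c, -, rfl⟩ := Finset.mem_image.1 hC
    obtain ⟨d, -, rfl⟩ := Finset.mem_image.1 hD
    rw [hdis c d x hxC hxD]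
  · intro C hC
    obtain ⟨c, hc, rfl⟩ := Finset.mem_image.1 hC
    rw [hcard]
    simpa using hc
  · intro C hC x hx
    obtain ⟨c, -, rfl⟩ := Finset.mem_image.1 hC
    obtain ⟨hx, -⟩ := (hφ c x).1 hx
    simpa using hx
  · intro C hC x hx y hxy
    obtain ⟨c, -, rfl⟩ := Finset.mem_image.1 hC
    obtain ⟨hx, hxc⟩ := (hφ c x).1 hx
    rw [or_iff_not_imp_right]
    intro hy
    have hy' : y ∈ ((⊤ : H.Subgraph).deleteVerts u).verts := by simpa using hy
    have hadj : K.Adj ⟨x, hx⟩ ⟨y, hy'⟩ := by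
      simp only [hK, Subgraph.coe_adj, Subgraph.deleteVerts_adj]
      simp at hx hy'
      simp [hx, hy', hxy]
    exact (hφ c y).2 ⟨hy', (c.mem_supp_congr_adj hadj).1 hxc⟩
  · rw [Finset.card_image_of_injective, ← Set.ncard_eq_toFinset_card',
      ← Set.ncard_eq_toFinset_card']
    · have hodd := K.odd_ncard_oddComponents
      have hv : Nat.card ((⊤ : H.Subgraph).deleteVerts u).verts + u.ncard = Fintype.card W := by
        rw [Nat.card_coe_set_eq, Subgraph.deleteVerts_verts, Subgraph.verts_top,
          ← Set.compl_eq_univ_sdiff, add_comm, Set.ncard_add_ncard_compl, Nat.card_eq_fintype_card]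
      rw [Nat.odd_iff, Nat.odd_iff] at hodd
      rw [Nat.even_iff] at he
      omega
    · intro c d hcd
      obtain ⟨x, hx⟩ := hne c
      exact hdis c d x hx (hcd ▸ hx)

lemma exists_odd_closed_of_not_isMatchable {V : Type*} [DecidableEq V] {G : SimpleGraph V}
    {s : Finset V} (h : ¬ G.IsMatchable s) (he : Even s.card) :
    ∃ B ⊆ s, ∃ 𝒞 : Finset (Finset V),
      (∀ C ∈ 𝒞, ∀ D ∈ 𝒞, ∀ x ∈ C, x ∈ D → C = D) ∧ (∀ C ∈ 𝒞, Odd C.card) ∧ (∀ C ∈ 𝒞, C ⊆ s) ∧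
      (∀ C ∈ 𝒞, ∀ x ∈ C, x ∉ B) ∧ (∀ C ∈ 𝒞, ∀ x ∈ C, ∀ y ∈ s, G.Adj x y → y ∈ C ∨ y ∈ B) ∧
      B.card + 2 ≤ 𝒞.card := by
  have h' : ¬ (G.induce (s : Set V)).IsMatchable Finset.univ := by
    rintro ⟨f, hf⟩
    refine h ⟨fun x => if hx : x ∈ s then f ⟨x, hx⟩ else x, fun x hx => ?_⟩
    have := hf ⟨x, hx⟩ (Finset.mem_univ _)
    simp only [hx, ↓reduceDIte]
    refine ⟨(f ⟨x, hx⟩).2, ?_, this.2.2⟩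
    have h2 : ((f ⟨x, hx⟩ : (s : Set V)) : V) ∈ s := (f ⟨x, hx⟩).2
    simp [this.2.1]
  obtain ⟨B, 𝒞, h1, h2, h3, h4, h5⟩ :=
    exists_odd_closed_of_not_isMatchable_univ h' (by simpa using he)
  let ι := Function.Embedding.subtype fun x => x ∈ (s : Set V)
  have hι : ∀ (C : Finset (s : Set V)) x, x ∈ C.map ι ↔ ∃ hx, (⟨x, hx⟩ : (s : Set V)) ∈ C := by
    intro C x
    simp [ι]
  have hmem : ∀ C ∈ 𝒞.map (Finset.mapEmbedding ι).toEmbedding, ∃ D ∈ 𝒞, D.map ι = C := by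
    intro C hC
    obtain ⟨D, hD, rfl⟩ := Finset.mem_map.1 hC
    exact ⟨D, hD, rfl⟩
  refine ⟨B.map ι, ?_, 𝒞.map (Finset.mapEmbedding ι).toEmbedding, ?_, ?_, ?_, ?_, ?_, ?_⟩
  · intro x hx
    exact ((hι B x).1 hx).1
  · intro C hC D hD x hxC hxD
    obtain ⟨C, hC', rfl⟩ := hmem C hC
    obtain ⟨D, hD', rfl⟩ := hmem D hD
    obtain ⟨_, hxC⟩ := (hι C x).1 hxC
    obtain ⟨_, hxD⟩ := (hι D x).1 hxD
    rw [h1 C hC' D hD' _ hxC hxD]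
  · intro C hC
    obtain ⟨C, hC', rfl⟩ := hmem C hC
    rw [Finset.card_map]
    exact h2 C hC'
  · intro C hC x hx
    obtain ⟨C, hC', rfl⟩ := hmem C hC
    exact ((hι C x).1 hx).1
  · intro C hC x hx hxB
    obtain ⟨C, hC', rfl⟩ := hmem C hC
    obtain ⟨_, hx⟩ := (hι C x).1 hx
    exact h3 C hC' _ hx ((hι B x).1 hxB).2
  · intro C hC x hx y hy hxy
    obtain ⟨C, hC', rfl⟩ := hmem C hC
    obtain ⟨_, hx⟩ := (hι C x).1 hx
    exact (h4 C hC' _ hx ⟨y, hy⟩ hxy).imp (fun h => (hι C y).2 ⟨hy, h⟩) fun h => (hι B y).2 ⟨hy, h⟩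
  · rwa [Finset.card_map, Finset.card_map]

lemma Connected.exists_adj_boundary {V : Type*} {G : SimpleGraph V} (hG : G.Connected)
    {A : Set V} {a b : V} (ha : a ∈ A) (hb : b ∉ A) : ∃ x ∈ A, ∃ y ∉ A, G.Adj x y := by
  obtain ⟨p⟩ := hG.preconnected a b
  obtain ⟨d, -, h1, h2⟩ := p.exists_boundary_dart A ha hb
  exact ⟨_, h1, _, h2, d.adj⟩

section WeaklyExtendable

variable {V : Type*} [Fintype V] [DecidableEq V] {G : SimpleGraph V} {k : ℕ}

lemma IsMatchable.exists_superset {t : Finset V} (hV : G.IsMatchable Finset.univ)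
    (ht : G.IsMatchable t) {m : ℕ} (htm : t.card ≤ 2 * m) (hm : 2 * m ≤ Fintype.card V) :
    ∃ s, t ⊆ s ∧ G.IsMatchable s ∧ s.card = 2 * m := by
  induction hd : 2 * m - t.card using Nat.strong_induction_on generalizing t with
  | _ d ih =>
    by_cases hc : t.card = 2 * m
    · exact ⟨t, le_rfl, ht, hc⟩
    obtain ⟨x, hx⟩ : ∃ x, x ∉ t := by
      by_contra! h
      have : t = Finset.univ := by ext; simp [h]
      rw [this, Finset.card_univ] at hc htm
      omega
    rcases hV.exchange ht (Finset.mem_univ x) hx with ⟨y, -, hy, hyx, h⟩ | ⟨y, -, hy, -⟩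
    · have hcard : (insert x (insert y t)).card = t.card + 2 := by
        rw [Finset.card_insert_of_notMem (by simp [hx, hyx.symm]), Finset.card_insert_of_notMem hy]
      obtain ⟨a, ha⟩ := ht.even_card
      obtain ⟨s, hs, h'⟩ := ih _ (by omega) h (by omega) rfl
      exact ⟨s, fun z hz => hs (by simp [hz]), h'⟩
    · simp at hy

/-- If matchings of exactly `k` edges extend to perfect matchings, so do smaller ones. -/
lemma isMatchable_compl_of_card_le (hV : G.IsMatchable Finset.univ)
    (hk : 2 * k < Fintype.card V)
    (hext : ∀ s, G.IsMatchable s → s.card = 2 * k → G.IsMatchable sᶜ)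
    {s : Finset V} (hs : G.IsMatchable s) (hsk : s.card ≤ 2 * k) : G.IsMatchable sᶜ := by
  induction hd : 2 * k - s.card using Nat.strong_induction_on generalizing s with
  | _ d ih =>
    by_cases hc : s.card = 2 * k
    · exact hext s hs hc
    obtain ⟨u, v, hu, hv, huv⟩ : ∃ u v, u ∉ s ∧ v ∉ s ∧ G.Adj u v := by
      obtain ⟨t, hst, ht, htc⟩ := IsMatchable.exists_superset hV hs hsk hk.le
      obtain ⟨x, hx⟩ : (tᶜ).Nonempty := by
        rw [← Finset.card_pos, Finset.card_compl]
        omega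
      obtain ⟨y, hy, hxy, -⟩ := (hext t ht htc).exists_partner hx
      rw [Finset.mem_compl] at hx hy
      exact ⟨x, y, fun h => hx (hst h), fun h => hy (hst h), hxy⟩
    have hcard : (insert u (insert v s)).card = s.card + 2 := by
      rw [Finset.card_insert_of_notMem (by simp [hu, huv.ne]), Finset.card_insert_of_notMem hv]
    obtain ⟨a, ha⟩ := hs.even_card
    have := ih _ (by omega) (hs.insert_pair huv hu hv) (by omega) rfl
    convert this.insert_pair huv (by simp) (by simp) using 1
    ext a
    simp only [Finset.mem_insert, Finset.mem_compl]
    grind only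

/-- Every matching of at most `k` edges extends to a perfect matching. -/
def IsWeaklyExtendable (G : SimpleGraph V) (k : ℕ) : Prop :=
  ∀ s, G.IsMatchable s → s.card ≤ 2 * k → G.IsMatchable sᶜ

lemma IsWeaklyExtendable.sdiff (hG : G.IsWeaklyExtendable k)
    {s : Finset V} (hs : G.IsMatchable s) {u v : V} (h : G.Adj u v)
    (hu : u ∉ s) (hv : v ∉ s) (hc : s.card + 2 ≤ 2 * k) :
    G.IsMatchable ((sᶜ.erase u).erase v) := by
  have hcard : (insert u (insert v s)).card = s.card + 2 := by
    rw [Finset.card_insert_of_notMem (by simp [hu, h.ne]), Finset.card_insert_of_notMem hv]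
  convert hG _ (hs.insert_pair h hu hv) (by omega) using 1
  ext a
  simp only [Finset.mem_erase, Finset.mem_compl, Finset.mem_insert]
  tauto

lemma IsWeaklyExtendable.sdiff_sdiff (hG : G.IsWeaklyExtendable k)
    {s : Finset V} (hs : G.IsMatchable s) {u v w z : V}
    (h : G.Adj u v) (h' : G.Adj w z) (hu : u ∉ s) (hv : v ∉ s) (hw : w ∉ s) (hz : z ∉ s)
    (huw : u ≠ w) (huz : u ≠ z) (hvw : v ≠ w) (hvz : v ≠ z) (hc : s.card + 4 ≤ 2 * k) :
    G.IsMatchable ((((sᶜ.erase u).erase v).erase w).erase z) := by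
  have hcard : (insert u (insert v s)).card = s.card + 2 := by
    rw [Finset.card_insert_of_notMem (by simp [hu, h.ne]), Finset.card_insert_of_notMem hv]
  convert hG.sdiff (hs.insert_pair h hu hv) h' (by simp [*, huw.symm, hvw.symm])
    (by simp [*, huz.symm, hvz.symm]) (by omega) using 1
  ext a
  simp only [Finset.mem_erase, Finset.mem_compl, Finset.mem_insert]
  tauto

/-- Deleting a matching of fewer than `k` edges leaves a connected graph. -/
lemma IsWeaklyExtendable.exists_adj_boundary (hG : G.IsWeaklyExtendable k)
    (hconn : G.Connected) {s : Finset V}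
    (hs : G.IsMatchable s) (hc : s.card + 2 ≤ 2 * k) {A : Finset V} {a b : V} (ha : a ∈ A)
    (hAs : Disjoint A s) (hbA : b ∉ A) (hbs : b ∉ s) :
    ∃ x ∈ A, ∃ y, y ∉ A ∧ y ∉ s ∧ G.Adj x y := by
  induction hn : s.card using Nat.strong_induction_on generalizing s A a b with
  | _ n ih =>
    rcases s.eq_empty_or_nonempty with rfl | ⟨x, hx⟩
    · obtain ⟨x, hx, y, hy, hxy⟩ := hconn.exists_adj_boundary (A := (A : Set V)) (a := a) (b := b)
        (by simpa using ha) (by simpa using hbA)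
      exact ⟨x, by simpa using hx, y, by simpa using hy, by simp, hxy⟩
    by_contra! hcon
    obtain ⟨x', hx', hxx', hs'⟩ := hs.exists_partner hx
    have hcard := card_erase_erase_add_two hx hx' hxx'.ne
    set s' := (s.erase x).erase x' with hs'_def
    have mem_s' : ∀ z, z ∈ s' ↔ z ≠ x' ∧ z ≠ x ∧ z ∈ s := by simp [s']
    have hxA : x ∉ A := fun h => Finset.disjoint_left.1 hAs h hx
    have hx'A : x' ∉ A := fun h => Finset.disjoint_left.1 hAs h hx'
    have hAs' : Disjoint A s' := hAs.mono_right fun z hz => ((mem_s' z).1 hz).2.2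
    have hA : G.IsMatchable A := by
      refine (hG s hs (by omega)).subset_of_closed ?_ ?_
      · intro z hz
        rw [Finset.mem_compl]
        exact Finset.disjoint_left.1 hAs hz
      · intro z hz y hy hyA
        exact hcon z hz y hyA (Finset.mem_compl.1 hy)
    have nadj : ∀ z ∈ A, ∀ y, y ∉ A → y ∉ s → ¬ G.Adj z y := hcon
    -- an edge to each side from the two ends of the matching edge is impossible
    have split : ∀ p q, (p = x ∧ q = x') ∨ (p = x' ∧ q = x) →
        ∀ c ∈ A, G.Adj p c → ∀ d, d ∉ A → d ∉ s → ¬ G.Adj q d := by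
      intro p q hpq c hc' hpc d hdA hds hqd
      have hcs : c ∉ s := Finset.disjoint_left.1 hAs hc'
      have hcd : c ≠ d := fun h => hdA (h ▸ hc')
      have hps : p ∈ s ∧ q ∈ s ∧ p ≠ q ∧ p ∉ s' ∧ q ∉ s' := by
        rcases hpq with ⟨rfl, rfl⟩ | ⟨rfl, rfl⟩
        · exact ⟨hx, hx', hxx'.ne, by simp [mem_s'], by simp [mem_s']⟩
        · exact ⟨hx', hx, hxx'.ne', by simp [mem_s'], by simp [mem_s']⟩
      have hpm := hG.sdiff_sdiff hs' hpc hqd hps.2.2.2.1 (fun h => hcs ((mem_s' _).1 h).2.2)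
        hps.2.2.2.2 (fun h => hds ((mem_s' _).1 h).2.2) hps.2.2.1
        (fun h => hds (h ▸ hps.1)) (fun h => hcs (h ▸ hps.2.1)) hcd (by omega)
      have hA' : G.IsMatchable (A.erase c) := by
        refine hpm.subset_of_closed ?_ ?_
        · intro z hz
          have hz' := Finset.mem_of_mem_erase hz
          have hzs : z ∉ s := Finset.disjoint_left.1 hAs hz'
          simp only [Finset.mem_erase, Finset.mem_compl]
          exact ⟨fun h => hdA (h ▸ hz'), fun h => hzs (h ▸ hps.2.1), (Finset.mem_erase.1 hz).1,
            fun h => hzs (h ▸ hps.1), fun h => hzs ((mem_s' _).1 h).2.2⟩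
        · intro z hz y hy hyA
          simp only [Finset.mem_erase, Finset.mem_compl, mem_s'] at hy hyA
          refine nadj z (Finset.mem_of_mem_erase hz) y (fun h => hyA ⟨hy.2.2.1, h⟩) fun h => ?_
          rcases hpq with ⟨rfl, rfl⟩ | ⟨rfl, rfl⟩
          · exact hy.2.2.2.2 ⟨hy.2.1, hy.2.2.2.1, h⟩
          · exact hy.2.2.2.2 ⟨hy.2.2.2.1, hy.2.1, h⟩
      obtain ⟨i, hi⟩ := hA.even_card
      obtain ⟨j, hj⟩ := hA'.even_card
      have := Finset.card_erase_add_one hc'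
      omega
    have toA : ∃ c ∈ A, G.Adj x c ∨ G.Adj x' c := by
      obtain ⟨c, hcA, y, hyA, hys, hcy⟩ := ih _ (by omega) hs' (by omega) ha hAs' hbA
        (fun h => hbs ((mem_s' _).1 h).2.2) rfl
      refine ⟨c, hcA, ?_⟩
      by_cases hy : y ∈ s
      · have : y = x' ∨ y = x := by
          by_contra! h
          exact hys ((mem_s' _).2 ⟨h.1, h.2, hy⟩)
        rcases this with rfl | rfl
        · exact .inr hcy.symm
        · exact .inl hcy.symm
      · exact absurd hcy (nadj c hcA y hyA hy)
    have toB : ∃ d, d ∉ A ∧ d ∉ s ∧ (G.Adj x d ∨ G.Adj x' d) := by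
      obtain ⟨c, hcA, y, hyA, hys, hcy⟩ := ih _ (by omega) hs' (by omega)
        (A := insert x (insert x' A)) (a := a) (b := b) (by simp [ha])
        (by simp [hAs', mem_s']) (by
          simp only [Finset.mem_insert, not_or]
          exact ⟨fun h => hbs (h ▸ hx), fun h => hbs (h ▸ hx'), hbA⟩)
        (fun h => hbs ((mem_s' _).1 h).2.2) rfl
      simp only [Finset.mem_insert, not_or] at hcA hyA
      have hy : y ∉ s := fun h => hys ((mem_s' _).2 ⟨hyA.2.1, hyA.1, h⟩)
      refine ⟨y, hyA.2.2, hy, ?_⟩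
      rcases hcA with rfl | rfl | hcA
      · exact .inl hcy
      · exact .inr hcy
      · exact absurd hcy (nadj c hcA y hyA.2.2 hy)
    -- hence one end is joined to both sides and the other to none
    have last : ∀ p q, (p = x ∧ q = x') ∨ (p = x' ∧ q = x) →
        ∀ c ∈ A, G.Adj p c → ∀ d, d ∉ A → d ∉ s → G.Adj p d → False := by
      intro p q hpq c hcA hpc d hdA hds hpd
      have hcs : c ∉ s := Finset.disjoint_left.1 hAs hcA
      have hqp : (q = x ∧ p = x') ∨ (q = x' ∧ p = x) := by tauto
      have hps : p ∈ s ∧ q ∈ s ∧ q ≠ p ∧ p ∉ s' ∧ q ∉ s' := by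
        rcases hpq with ⟨rfl, rfl⟩ | ⟨rfl, rfl⟩
        · exact ⟨hx, hx', hxx'.ne', by simp [mem_s'], by simp [mem_s']⟩
        · exact ⟨hx', hx, hxx'.ne, by simp [mem_s'], by simp [mem_s']⟩
      have hpm := hG.sdiff hs' hpc hps.2.2.2.1 (fun h => hcs ((mem_s' _).1 h).2.2) (by omega)
      obtain ⟨y, hy, hqy, -⟩ := hpm.exists_partner (x := q) (by
        simp only [Finset.mem_erase, Finset.mem_compl]
        exact ⟨fun h => hcs (h ▸ hps.2.1), hps.2.2.1, hps.2.2.2.2⟩)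
      simp only [Finset.mem_erase, Finset.mem_compl, mem_s'] at hy
      have hys : y ∉ s := by
        intro h
        have := hqy.ne
        rcases hpq with ⟨rfl, rfl⟩ | ⟨rfl, rfl⟩
        · exact hy.2.2 ⟨this.symm, hy.2.1, h⟩
        · exact hy.2.2 ⟨hy.2.1, this.symm, h⟩
      by_cases hyA : y ∈ A
      · exact split q p hqp y hyA hqy d hdA hds hpd
      · exact split p q hpq c hcA hpc y hyA hys hqy
    obtain ⟨c, hcA, hc'⟩ := toA
    obtain ⟨d, hdA, hds, hd⟩ := toB
    rcases hc' with h1 | h1 <;> rcases hd with h2 | h2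
    · exact last x x' (.inl ⟨rfl, rfl⟩) c hcA h1 d hdA hds h2
    · exact split x x' (.inl ⟨rfl, rfl⟩) c hcA h1 d hdA hds h2
    · exact split x' x (.inr ⟨rfl, rfl⟩) c hcA h1 d hdA hds h2
    · exact last x' x (.inr ⟨rfl, rfl⟩) c hcA h1 d hdA hds h2

lemma IsWeaklyExtendable.exists_common_neighbors (hG : G.IsWeaklyExtendable k)
    {I s : Finset V} {u v : V}
    (hV : 2 * I.card ≤ Fintype.card V ∧ Fintype.card V + 2 ≤ 2 * I.card + 2 * k)
    (hdom : ∀ x ∉ I, ∃ w ∈ I, G.Adj x w)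
    (hs : G.IsMatchable s) (huv : G.Adj u v) (hu : u ∉ s) (hv : v ∉ s) (huI : u ∉ I)
    (hvI : v ∉ I) (hsI : Disjoint s I) (hc : s.card + 2 + 2 * I.card = Fintype.card V)
    (hind : ∀ x ∈ I, ∀ y ∈ I, ¬ G.Adj x y) :
    (∃ w ∈ I, G.Adj u w ∧ G.Adj v w ∧ ∀ y ∈ I, G.Adj u y ∨ G.Adj v y → y = w) ∧
      ∃ x, x ∉ I ∧ x ∉ s ∧ G.Adj u x ∧ G.Adj v x ∧
        ∀ y, y ∉ I → y ∉ s → y ≠ u → y ≠ v → G.Adj u y ∨ G.Adj v y → y = x := by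
  have bound : ∀ t, G.IsMatchable t → Disjoint t I → t.card ≤ 2 * k →
      t.card + 2 * I.card ≤ Fintype.card V := by
    intro t ht htI htk
    have := (hG t ht htk).two_mul_card_indep_le (I := I)
      (fun x hx => by simpa using Finset.disjoint_right.1 htI hx) hind
    rw [Finset.card_compl] at this
    have := Finset.card_le_univ t
    omega
  have hcs : ∀ a b, a ≠ b → a ∉ s → b ∉ s → (insert a (insert b s)).card = s.card + 2 := by
    intro a b hab ha hb
    rw [Finset.card_insert_of_notMem (by simp [hab, ha]), Finset.card_insert_of_notMem hb]
  have ndisj : ∀ {x}, x ∈ I → x ∉ s := fun hx => Finset.disjoint_right.1 hsI hx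
  -- the vertices outside `I`, `s` and the edge form an independent set
  set U : Finset V := (I ∪ insert u (insert v s))ᶜ with hU
  have hdU : Disjoint I (insert u (insert v s)) := by
    rw [Finset.disjoint_left]
    intro a ha
    simp only [Finset.mem_insert, not_or]
    exact ⟨fun h => huI (h ▸ ha), fun h => hvI (h ▸ ha), ndisj ha⟩
  have hUc : U.card = I.card := by
    rw [hU, Finset.card_compl, Finset.card_union_of_disjoint hdU, hcs u v huv.ne hu hv]
    omega
  have hUi : ∀ x ∈ U, ∀ y ∈ U, ¬ G.Adj x y := by
    intro x hx y hy hxy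
    simp only [hU, Finset.mem_compl, Finset.mem_union, not_or] at hx hy
    have h1 := bound _ ((hs.insert_pair huv hu hv).insert_pair hxy hx.2 hy.2) (by
      simp only [Finset.disjoint_insert_left]
      exact ⟨hx.1, hy.1, huI, hvI, hsI⟩)
    rw [Finset.card_insert_of_notMem (by rw [Finset.mem_insert]; exact not_or.2 ⟨hxy.ne, hx.2⟩),
      Finset.card_insert_of_notMem hy.2, hcs u v huv.ne hu hv] at h1
    have := h1 (by omega)
    omega
  have two : ∀ {a b c d}, G.Adj a b → G.Adj c d → a ∉ s → b ∉ s → c ∉ s → d ∉ s →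
      a ≠ c → a ≠ d → b ≠ c → b ≠ d →
      G.IsMatchable (insert c (insert d (insert a (insert b s)))) ∧
        (insert c (insert d (insert a (insert b s)))).card = s.card + 4 := by
    intro a b c d hab hcd ha hb hc' hd hac had hbc hbd
    have h1 : c ∉ insert a (insert b s) := by simp [hac.symm, hbc.symm, hc']
    have h2 : d ∉ insert a (insert b s) := by simp [had.symm, hbd.symm, hd]
    refine ⟨(hs.insert_pair hab ha hb).insert_pair hcd h1 h2, ?_⟩
    rw [Finset.card_insert_of_notMem (by rw [Finset.mem_insert]; exact not_or.2 ⟨hcd.ne, h1⟩),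
      Finset.card_insert_of_notMem h2, hcs a b hab.ne ha hb]
  have same : ∀ y ∈ I, ∀ z ∈ I, G.Adj u y → G.Adj v z → y = z := by
    intro y hy z hz huy hvz
    by_contra hyz
    have h := two huy hvz hu (ndisj hy) hv (ndisj hz) huv.ne (fun h => huI (h ▸ hz))
      (fun h => hvI (h ▸ hy)) hyz
    have h2 := (hG _ h.1 (by omega)).two_mul_card_indep_le (I := U) (by
      intro a ha
      simp only [hU, Finset.mem_compl, Finset.mem_union, Finset.mem_insert, not_or] at ha ⊢
      exact ⟨ha.2.2.1, fun h => ha.1 (h ▸ hz), ha.2.1, fun h => ha.1 (h ▸ hy), ha.2.2.2⟩) hUi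
    rw [hUc, Finset.card_compl, h.2] at h2
    have := Finset.card_pos.2 ⟨y, hy⟩
    omega
  obtain ⟨w, hw, huw⟩ := hdom u huI
  obtain ⟨w', hw', hvw⟩ := hdom v hvI
  obtain rfl := same w hw w' hw' huw hvw
  have uniq : ∀ y ∈ I, G.Adj u y ∨ G.Adj v y → y = w := by
    rintro y hy (h | h)
    · exact same y hy w hw h hvw
    · exact (same w hw y hy huw h).symm
  refine ⟨⟨w, hw, huw, hvw, uniq⟩, ?_⟩
  have hwu : w ≠ u := huw.ne'
  have hwv : w ≠ v := hvw.ne'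
  have out : ∀ p q, G.Adj p w → p ∉ s → q ∉ s → p ≠ q → q ∉ I →
      (∀ y ∈ I, G.Adj q y → y = w) → ∃ x, x ∉ I ∧ x ∉ s ∧ x ≠ p ∧ G.Adj q x := by
    intro p q hpw hp hq hpq hqI hquniq
    obtain ⟨x, hx, hqx, -⟩ := (hG _ (hs.insert_pair hpw hp (ndisj hw)) (by
      rw [hcs p w hpw.ne hp (ndisj hw)]; omega)).exists_partner (x := q) (by
      simp only [Finset.mem_compl, Finset.mem_insert, not_or]
      exact ⟨hpq.symm, fun h => hqI (h ▸ hw), hq⟩)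
    simp only [Finset.mem_compl, Finset.mem_insert, not_or] at hx
    exact ⟨x, fun h => hx.2.1 (hquniq x h hqx), hx.2.2, hx.1, hqx⟩
  obtain ⟨x, hxI, hxs, hxu, hvx⟩ :=
    out u v huw hu hv huv.ne hvI fun y hy h => uniq y hy (.inr h)
  obtain ⟨x', hxI', hxs', hxv', hux⟩ :=
    out v u hvw hv hu huv.ne' huI fun y hy h => uniq y hy (.inl h)
  have same' : ∀ y z, y ∉ I → z ∉ I → y ∉ s → z ∉ s → y ≠ v → z ≠ u → G.Adj u y → G.Adj v z →
      y = z := by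
    intro y z hy hz hys hzs hyv hzu huy hvz
    by_contra hyz
    have h := two huy hvz hu hys hv hzs huv.ne hzu.symm hyv hyz
    have := bound _ h.1 (by
      simp only [Finset.disjoint_insert_left]
      exact ⟨hvI, hz, huI, hy, hsI⟩) (by omega)
    omega
  obtain rfl := same' x' x hxI' hxI hxs' hxs hxv' hxu hux hvx
  refine ⟨x', hxI, hxs, hux, hvx, ?_⟩
  rintro y hy hys hyu hyv (h | h)
  · exact same' y x' hy hxI hys hxs hyv hxu h hvx
  · exact (same' x' y hxI hy hxs hys hxv' hyu hux h).symm

/-- Independent sets are small. -/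
lemma IsWeaklyExtendable.two_mul_card_indep_add_le (hG : G.IsWeaklyExtendable k)
    (hV : G.IsMatchable Finset.univ)
    (hconn : G.Connected) (hcard : 2 * k < Fintype.card V) (hcol : ¬ G.Colorable 2)
    {I : Finset V} (hind : ∀ x ∈ I, ∀ y ∈ I, ¬ G.Adj x y) :
    2 * I.card + 2 * k ≤ Fintype.card V := by
  classical
  obtain ⟨J, hJ, hmax⟩ := Finset.exists_max_image
    (Finset.univ.filter fun I : Finset V => ∀ x ∈ I, ∀ y ∈ I, ¬ G.Adj x y) Finset.card
    ⟨I, by simpa using hind⟩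
  have hIJ := hmax I (by simpa using hind)
  simp only [Finset.mem_filter, Finset.mem_univ, true_and] at hJ hmax
  clear hind
  refine le_trans (by omega) (?_ : 2 * J.card + 2 * k ≤ _)
  clear hIJ I
  by_contra! hlt
  obtain ⟨s, hsJ, hs, hsc⟩ := hV.exists_of_indep (Finset.subset_univ J) hJ
  rw [Finset.card_univ] at hsc
  have hsd : Disjoint s J := (Finset.subset_sdiff.1 hsJ).2
  obtain ⟨j, hj⟩ := hs.even_card
  obtain ⟨n, hn⟩ := hV.even_card
  rw [Finset.card_univ] at hn
  rcases s.eq_empty_or_nonempty with rfl | ⟨u, hu⟩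
  · refine hcol ⟨Coloring.mk (fun x => if x ∈ J then 0 else 1) ?_⟩
    intro x y hxy
    by_cases hx : x ∈ J <;> by_cases hy : y ∈ J
    · exact absurd hxy (hJ x hx y hy)
    · simp [hx, hy]
    · simp [hx, hy]
    · exfalso
      have h2 := (hG _ (isMatchable_pair hxy) (by
        rw [Finset.card_pair hxy.ne]
        have := hV.even_card
        simp at hsc
        omega)).two_mul_card_indep_le (I := J) (by
          intro a ha
          simp only [Finset.mem_compl, Finset.mem_insert, Finset.mem_singleton, not_or]
          exact ⟨fun h => hx (h ▸ ha), fun h => hy (h ▸ ha)⟩) hJ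
      rw [Finset.card_compl, Finset.card_pair hxy.ne] at h2
      simp at hsc
      omega
  obtain ⟨v, hv, huv, hs'⟩ := hs.exists_partner hu
  have hc := card_erase_erase_add_two hu hv huv.ne
  have hsub : (s.erase u).erase v ⊆ s := (Finset.erase_subset _ _).trans (Finset.erase_subset _ _)
  have hu' : u ∉ (s.erase u).erase v := by simp
  have hv' : v ∉ (s.erase u).erase v := by simp
  generalize (s.erase u).erase v = r at hs' hc hsub hu' hv'
  have hrd : Disjoint r J := hsd.mono_left hsub
  have huJ := Finset.disjoint_left.1 hsd hu
  have hvJ := Finset.disjoint_left.1 hsd hv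
  have hdom : ∀ x ∉ J, ∃ w ∈ J, G.Adj x w := by
    intro x hx
    by_contra! h
    have := hmax (insert x J) (by
      intro a ha b hb hab
      rw [Finset.mem_insert] at ha hb
      rcases ha with rfl | ha <;> rcases hb with rfl | hb
      · exact hab.ne rfl
      · exact h b hb hab
      · exact h a ha hab.symm
      · exact hJ a ha b hb hab)
    rw [Finset.card_insert_of_notMem hx] at this
    omega
  obtain ⟨⟨w, hw, huw, hvw, hwu⟩, x, hxJ, hxr, hux, hvx, hxu⟩ :=
    hG.exists_common_neighbors (by omega) hdom hs' huv hu' hv' huJ hvJ hrd (by omega) hJ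
  obtain ⟨⟨w', hw', huw', hxw', hwu'⟩, x', hxJ', hxr', hux', hxx', hxu'⟩ :=
    hG.exists_common_neighbors (by omega) hdom hs' hux hu' hxr huJ hxJ hrd (by omega) hJ
  obtain rfl := hwu w' hw' (.inl huw')
  have hvx' := hxu' v hvJ hv' huv.ne' hvx.ne (.inl huv)
  have hwr : w' ∉ r := Finset.disjoint_right.1 hrd hw
  have hb : ∃ b, b ∉ ({u, v, x, w'} : Finset V) ∧ b ∉ r := by
    by_contra! h
    have h1 : (Finset.univ : Finset V) ⊆ {u, v, x, w'} ∪ r := fun b _ =>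
      Finset.mem_union.2 (or_iff_not_imp_left.2 (h b))
    have h2 := (Finset.card_le_card h1).trans (Finset.card_union_le _ _)
    have h3 := Finset.card_le_four (a := u) (b := v) (c := x) (d := w')
    rw [Finset.card_univ] at h2
    omega
  obtain ⟨b, hb, hbr⟩ := hb
  obtain ⟨a, ha, y, hy, hyr, hay⟩ := hG.exists_adj_boundary hconn hs' (by omega)
    (A := {u, v, x, w'}) (a := u) (b := b) (by simp)
    (by simp [hu', hv', hxr, hwr]) hb hbr
  simp only [Finset.mem_insert, Finset.mem_singleton, not_or] at ha hy
  obtain ⟨hyu, hyv, hyx, hyw⟩ := hy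
  rcases ha with rfl | rfl | rfl | rfl
  · by_cases hyJ : y ∈ J
    · exact hyw (hwu y hyJ (.inl hay))
    · exact hyx (hxu y hyJ hyr hyu hyv (.inl hay))
  · by_cases hyJ : y ∈ J
    · exact hyw (hwu y hyJ (.inr hay))
    · exact hyx (hxu y hyJ hyr hyu hyv (.inr hay))
  · by_cases hyJ : y ∈ J
    · exact hyw (hwu' y hyJ (.inr hay))
    · exact hyv ((hxu' y hyJ hyr hyu hyx (.inr hay)).trans hvx'.symm)
  · have h1 : v ∉ insert a (insert y r) := by simp [hvw.ne, Ne.symm hyv, hv']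
    have h2 : x ∉ insert a (insert y r) := by simp [hxw'.ne, Ne.symm hyx, hxr]
    obtain ⟨p, hp, hup, -⟩ := (hG _ ((hs'.insert_pair hay hwr hyr).insert_pair hvx h1 h2) (by
      have := Finset.card_insert_le y r
      have := Finset.card_insert_le a (insert y r)
      have := Finset.card_insert_le x (insert a (insert y r))
      have := Finset.card_insert_le v (insert x (insert a (insert y r)))
      omega)).exists_partner (x := u) (by
        simp [huv.ne, hux.ne, huw.ne, Ne.symm hyu, hu'])
    simp only [Finset.mem_compl, Finset.mem_insert, not_or] at hp
    by_cases hpJ : p ∈ J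
    · exact hp.2.2.1 (hwu p hpJ (.inl hup))
    · exact hp.2.1 (hxu p hpJ hp.2.2.2.2 hup.ne' hp.1 (.inl hup))

lemma IsWeaklyExtendable.false_of_odd_closed (hG : G.IsWeaklyExtendable k)
    (hV : G.IsMatchable Finset.univ)
    (hconn : G.Connected) (hcol : ¬ G.Colorable 2) {s B : Finset V} (hs : G.IsMatchable s)
    (hsk : s.card + 4 ≤ 2 * k) (hcard : s.card + (2 * k + 2) = Fintype.card V)
    (𝒞 : Finset (Finset V)) (hdis : ∀ C ∈ 𝒞, ∀ D ∈ 𝒞, ∀ x ∈ C, x ∈ D → C = D)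
    (hodd : ∀ C ∈ 𝒞, Odd C.card) (hsub : ∀ C ∈ 𝒞, ∀ x ∈ C, x ∉ s) (hBs : ∀ x ∈ B, x ∉ s)
    (hB : ∀ C ∈ 𝒞, ∀ x ∈ C, x ∉ B)
    (hclosed : ∀ C ∈ 𝒞, ∀ x ∈ C, ∀ y ∉ s, G.Adj x y → y ∈ C ∨ y ∈ B)
    (hBc : 2 ≤ B.card) (h𝒞 : B.card ≤ 𝒞.card) : False := by
  have hBadj : ∀ b ∈ B, ∀ w ∉ s, G.Adj b w → ∃ C ∈ 𝒞, w ∈ C := by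
    intro b hb w hw hbw
    by_contra! hcon
    have := (hG.sdiff hs hbw (hBs b hb) hw (by omega)).card_le_of_odd_closed (B := B.erase b) 𝒞
      hdis hodd (by
        intro C hC x hx
        simp only [Finset.mem_erase, Finset.mem_compl]
        exact ⟨fun h => hcon C hC (h ▸ hx), fun h => hB C hC x hx (h ▸ hb), hsub C hC x hx⟩) (by
        intro C hC x hx y hy hxy
        simp only [Finset.mem_erase, Finset.mem_compl] at hy ⊢
        exact (hclosed C hC x hx y hy.2.2 hxy).imp_right fun h => ⟨hy.2.1, h⟩)
    have := Finset.card_erase_add_one hb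
    omega
  obtain ⟨b₀, hb₀⟩ := Finset.card_pos.1 (by omega : 0 < B.card)
  have hall : ∀ x ∉ s, x ∈ B ∨ ∃ C ∈ 𝒞, x ∈ C := by
    by_contra! hcon
    obtain ⟨x, hxs, hxB, hxC⟩ := hcon
    obtain ⟨c, hc, y, hy, hys, hcy⟩ := hG.exists_adj_boundary hconn hs (by omega)
      (A := B ∪ 𝒞.biUnion id) (a := b₀) (b := x) (by simp [hb₀])
      (by
        rw [Finset.disjoint_left]
        intro a ha
        simp only [Finset.mem_union, Finset.mem_biUnion, id] at ha
        rcases ha with h | ⟨C, hC, h⟩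
        · exact hBs a h
        · exact hsub C hC a h) (by simpa [hxB] using hxC) hxs
    simp only [Finset.mem_union, Finset.mem_biUnion, id, not_or, not_exists, not_and] at hc hy
    rcases hc with h | ⟨C, hC, h⟩
    · obtain ⟨C, hC, h⟩ := hBadj c h y hys hcy
      exact hy.2 C hC h
    · rcases hclosed C hC c h y hys hcy with h | h
      · exact hy.2 C hC h
      · exact hy.1 h
  by_cases hone : ∀ C ∈ 𝒞, C.card ≤ 1
  · have h1 : sᶜ ⊆ B ∪ 𝒞.biUnion id := by
      intro x hx
      simpa using hall x (by simpa using hx)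
    have h2 := (Finset.card_le_card h1).trans (Finset.card_union_le _ _)
    have h3 := Finset.card_biUnion_le_card_mul 𝒞 id 1 hone
    rw [Finset.card_compl] at h2
    have h5 := (hG s hs (by omega)).card_le_of_odd_closed (B := B) 𝒞 hdis hodd
      (fun C hC x hx => by simpa using hsub C hC x hx)
      (fun C hC x hx y hy => hclosed C hC x hx y (by simpa using hy))
    have := hG.two_mul_card_indep_add_le hV hconn (by omega) hcol (I := B) (by
      intro x hx y hy hxy
      obtain ⟨C, hC, h⟩ := hBadj x hx y (hBs y hy) hxy
      exact hB C hC y h hy)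
    omega
  push Not at hone
  obtain ⟨C, hC, hC1⟩ := hone
  obtain ⟨i, hi⟩ := hodd C hC
  obtain ⟨a, ha⟩ := Finset.card_pos.1 (by omega : 0 < C.card)
  obtain ⟨c₁, hc₁, b₁, hb₁, hb₁s, h₁⟩ := hG.exists_adj_boundary hconn hs (by omega)
    (A := C) (a := a) (b := b₀) ha (Finset.disjoint_left.2 (hsub C hC))
    (fun h => hB C hC _ h hb₀) (hBs _ hb₀)
  have hb₁B : b₁ ∈ B := (hclosed C hC c₁ hc₁ b₁ hb₁s h₁).resolve_left hb₁
  have hc₁s := hsub C hC c₁ hc₁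
  have hcc := Finset.card_erase_add_one hc₁
  have hbc := Finset.card_erase_add_one hb₁B
  obtain ⟨a', ha'⟩ := Finset.card_pos.1 (by omega : 0 < (C.erase c₁).card)
  obtain ⟨b', hb'⟩ := Finset.card_pos.1 (by omega : 0 < (B.erase b₁).card)
  rw [Finset.mem_erase] at hb'
  have hCB : ∀ {x y}, x ∈ C → y ∈ B → x ≠ y := fun hx hy h => hB C hC _ hx (h ▸ hy)
  obtain ⟨c₂, hc₂, b₂, hb₂, hb₂s, h₂⟩ := hG.exists_adj_boundary hconn
    (hs.insert_pair h₁ hc₁s hb₁s) (by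
      have := Finset.card_insert_le b₁ s
      have := Finset.card_insert_le c₁ (insert b₁ s)
      omega) (A := C.erase c₁) (a := a') (b := b') ha'
    (by
      rw [Finset.disjoint_left]
      intro x hx
      rw [Finset.mem_erase] at hx
      simp only [Finset.mem_insert, not_or]
      exact ⟨hx.1, hCB hx.2 hb₁B, hsub C hC x hx.2⟩)
    (fun h => hCB (Finset.mem_of_mem_erase h) hb'.2 rfl)
    (by
      simp only [Finset.mem_insert, not_or]
      exact ⟨(hCB hc₁ hb'.2).symm, hb'.1, hBs _ hb'.2⟩)
  simp only [Finset.mem_insert, Finset.mem_erase, not_or] at hc₂ hb₂s hb₂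
  have hb₂B : b₂ ∈ B := (hclosed C hC c₂ hc₂.2 b₂ hb₂s.2.2 h₂).resolve_left
    fun h => hb₂ ⟨hb₂s.1, h⟩
  have hc₂s := hsub C hC c₂ hc₂.2
  have hM := hG.sdiff_sdiff hs h₁ h₂ hc₁s hb₁s hc₂s hb₂s.2.2 (Ne.symm hc₂.1) (Ne.symm hb₂s.1)
    (hCB hc₂.2 hb₁B).symm (Ne.symm hb₂s.2.1) hsk
  have hBe := Finset.card_erase_add_one (Finset.mem_erase.2 ⟨hb₂s.2.1, hb₂B⟩)
  have hCe := card_erase_erase_add_two hc₁ hc₂.2 (Ne.symm hc₂.1)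
  obtain ⟨d, hd⟩ := Finset.card_pos.1 (by omega : 0 < ((C.erase c₁).erase c₂).card)
  have hCsub : (C.erase c₁).erase c₂ ⊆ C :=
    (Finset.erase_subset _ _).trans (Finset.erase_subset _ _)
  have hnot : (C.erase c₁).erase c₂ ∉ 𝒞.erase C := by
    intro h
    rw [Finset.mem_erase] at h
    exact h.1 (hdis _ h.2 C hC d hd (hCsub hd))
  have h𝒞' := Finset.card_erase_add_one hC
  have := hM.card_le_of_odd_closed (B := (B.erase b₁).erase b₂)
    (insert ((C.erase c₁).erase c₂) (𝒞.erase C)) (by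
      intro D hD E hE x hxD hxE
      rw [Finset.mem_insert, Finset.mem_erase] at hD hE
      rcases hD with rfl | hD <;> rcases hE with rfl | hE
      · rfl
      · exact absurd (hdis _ hE.2 C hC x hxE (hCsub hxD)) hE.1
      · exact absurd (hdis _ hD.2 C hC x hxD (hCsub hxE)) hD.1
      · exact hdis _ hD.2 _ hE.2 x hxD hxE) (by
      intro D hD
      rw [Finset.mem_insert, Finset.mem_erase] at hD
      rcases hD with rfl | hD
      · exact ⟨i - 1, by omega⟩
      · exact hodd D hD.2) (by
      intro D hD x hx
      rw [Finset.mem_insert, Finset.mem_erase] at hD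
      simp only [Finset.mem_erase, Finset.mem_compl]
      rcases hD with rfl | hD
      · have hxC := hCsub hx
        simp only [Finset.mem_erase] at hx
        exact ⟨hCB hxC hb₂B, hx.1, hCB hxC hb₁B, hx.2.1, hsub C hC x hxC⟩
      · refine ⟨fun h => hB D hD.2 x hx (h ▸ hb₂B), fun h => hD.1 ?_,
          fun h => hB D hD.2 x hx (h ▸ hb₁B), fun h => hD.1 ?_, hsub D hD.2 x hx⟩
        · exact hdis D hD.2 C hC x hx (h ▸ hc₂.2)
        · exact hdis D hD.2 C hC x hx (h ▸ hc₁)) (by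
      intro D hD x hx y hy hxy
      rw [Finset.mem_insert, Finset.mem_erase] at hD
      simp only [Finset.mem_erase, Finset.mem_compl] at hy ⊢
      rcases hD with rfl | hD
      · simp only [Finset.mem_erase]
        have := hclosed C hC x (hCsub hx) y hy.2.2.2.2 hxy
        tauto
      · have := hclosed D hD.2 x hx y hy.2.2.2.2 hxy
        tauto)
  rw [Finset.card_insert_of_notMem hnot] at this
  omega

/-- For small orders, the complement of any set of `2 * k` vertices has a perfect matching. -/
theorem IsWeaklyExtendable.isMatchable_compl (hG : G.IsWeaklyExtendable k)
    (hV : G.IsMatchable Finset.univ)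
    (hconn : G.Connected) (hcol : ¬ G.Colorable 2)
    (hcard : Fintype.card V + 2 ≤ 4 * k) {S : Finset V} (hS : S.card = 2 * k) :
    G.IsMatchable Sᶜ := by
  classical
  by_contra hcon
  obtain ⟨⟨S', s⟩, hSs, hmax⟩ := Finset.exists_max_image
    (Finset.univ.filter fun p : Finset V × Finset V =>
      p.1.card = 2 * k ∧ ¬ G.IsMatchable p.1ᶜ ∧ p.2 ⊆ p.1 ∧ G.IsMatchable p.2)
    (fun p => p.2.card) ⟨(S, ∅), by simp [hS, hcon, isMatchable_empty]⟩
  simp only [Finset.mem_filter, Finset.mem_univ, true_and, Prod.forall, and_imp] at hSs hmax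
  clear hcon hS S
  obtain ⟨hS, hcon, hsS, hs⟩ := hSs
  have hSn : ¬ G.IsMatchable S' := fun h => hcon (hG _ h hS.le)
  have hsc : s.card < S'.card := by
    refine lt_of_le_of_ne (Finset.card_le_card hsS) fun h => hSn ?_
    rwa [← Finset.eq_of_subset_of_card_le hsS h.ge]
  have hev : s.card + 2 ≤ S'.card := by
    obtain ⟨i, hi⟩ := hs.even_card
    omega
  have hcs := Finset.card_sdiff_add_card_eq_card hsS
  obtain ⟨x, hx, x', hx', hxx'⟩ := Finset.one_lt_card.1 (by omega : 1 < (S' \ s).card)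
  rw [Finset.mem_sdiff] at hx hx'
  have hJ : ∀ a ∈ S', a ∉ s → ∀ b ∈ S', b ∉ s → ¬ G.Adj a b := by
    intro a ha has b hb hbs hab
    have := hmax S' (insert a (insert b s)) hS hcon
      (Finset.insert_subset ha (Finset.insert_subset hb hsS)) (hs.insert_pair hab has hbs)
    rw [Finset.card_insert_of_notMem (by rw [Finset.mem_insert]; exact not_or.2 ⟨hab.ne, has⟩),
      Finset.card_insert_of_notMem hbs] at this
    omega
  obtain ⟨y, hy, hxy, -⟩ := (hG s hs (by omega)).exists_partner (x := x) (by simpa using hx.2)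
  rw [Finset.mem_compl] at hy
  have hyS : y ∉ S' := fun h => hJ x hx.1 hx.2 y h hy hxy
  have hyS2 : y ∉ S'.erase x' := fun h => hyS (Finset.mem_of_mem_erase h)
  have hmat : G.IsMatchable (insert y (S'.erase x'))ᶜ := by
    by_contra hcon'
    have := hmax (insert y (S'.erase x')) (insert x (insert y s)) (by
      rw [Finset.card_insert_of_notMem hyS2, Finset.card_erase_add_one hx'.1, hS]) hcon' (by
      intro a ha
      simp only [Finset.mem_insert, Finset.mem_erase] at ha ⊢
      rcases ha with rfl | rfl | ha
      · exact .inr ⟨hxx', hx.1⟩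
      · exact .inl rfl
      · exact .inr ⟨fun h => hx'.2 (h ▸ ha), hsS ha⟩) (hs.insert_pair hxy hx.2 hy)
    rw [Finset.card_insert_of_notMem (by rw [Finset.mem_insert]; exact not_or.2 ⟨hxy.ne, hx.2⟩),
      Finset.card_insert_of_notMem hy] at this
    omega
  have hx'y : x' ≠ y := fun h => hyS (h ▸ hx'.1)
  obtain ⟨z, hz, hxz, hL⟩ := hmat.exists_partner (x := x') (by simp [hx'y])
  simp only [Finset.mem_compl, Finset.mem_insert, Finset.mem_erase, not_or, not_and] at hz
  have hzS : z ∉ S' := hz.2 hxz.ne'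
  have hLeq : ((insert y (S'.erase x'))ᶜ.erase x').erase z = (S'ᶜ.erase y).erase z := by
    ext a
    simp only [Finset.mem_erase, Finset.mem_compl, Finset.mem_insert]
    have : a = x' → a ∈ S' := fun h => h ▸ hx'.1
    tauto
  rw [hLeq] at hL
  have hcL := card_erase_erase_add_two (s := S'ᶜ) (by simpa using hyS) (by simpa using hzS)
    (Ne.symm hz.1)
  rw [Finset.card_compl] at hcL
  obtain ⟨B, hBS, 𝒞, hdis, hodd, hsub, hBC, hclosed, hcard⟩ :=
    exists_odd_closed_of_not_isMatchable hSn (by simp [hS])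
  have hmemL : ∀ a, a ∉ (S'ᶜ.erase y).erase z ↔ a ∈ S' ∨ a = y ∨ a = z := by
    intro a
    simp only [Finset.mem_erase, Finset.mem_compl]
    tauto
  have hBc : (insert y (insert z B)).card = B.card + 2 := by
    rw [Finset.card_insert_of_notMem, Finset.card_insert_of_notMem fun h => hzS (hBS h)]
    rw [Finset.mem_insert]
    exact not_or.2 ⟨Ne.symm hz.1, fun h => hyS (hBS h)⟩
  refine hG.false_of_odd_closed hV hconn hcol (B := insert y (insert z B)) hL (by omega) (by omega)
    𝒞 hdis hodd ?_ ?_ ?_ ?_ (by omega) (by omega)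
  · intro C hC a ha
    exact (hmemL a).2 (.inl (hsub C hC ha))
  · intro a ha
    simp only [Finset.mem_insert] at ha
    rw [hmemL]
    rcases ha with h | h | h
    · exact .inr (.inl h)
    · exact .inr (.inr h)
    · exact .inl (hBS h)
  · intro C hC a ha
    simp only [Finset.mem_insert, not_or]
    exact ⟨fun h => hyS (h ▸ hsub C hC ha), fun h => hzS (h ▸ hsub C hC ha), hBC C hC a ha⟩
  · intro C hC a ha b hb hab
    rw [hmemL] at hb
    simp only [Finset.mem_insert]
    rcases hb with h | h | h
    · have := hclosed C hC a ha b h hab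
      tauto
    · tauto
    · tauto

end WeaklyExtendable

lemma lt_degree_of_isMatchable_compl {V : Type*} [Fintype V] [DecidableEq V] {G : SimpleGraph V}
    [DecidableRel G.Adj] {n : ℕ} (hn : n < Fintype.card V)
    (h : ∀ S : Finset V, S.card = n → G.IsMatchable Sᶜ) (v : V) : n < G.degree v := by
  by_contra! hd
  obtain ⟨S, hS, hSv, hSn⟩ := Finset.exists_subsuperset_card_eq
    (s := G.neighborFinset v) (t := Finset.univ.erase v) (n := n)
    (fun x hx => by simpa using ((G.mem_neighborFinset v x).1 hx).ne')
    (by simpa using hd)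
    (by rw [Finset.card_erase_of_mem (Finset.mem_univ _), Finset.card_univ]; omega)
  obtain ⟨w, hw, hvw, -⟩ := (h S hSn).exists_partner (x := v) (by
    rw [Finset.mem_compl]
    exact fun h => Finset.notMem_erase v _ (hSv h))
  exact Finset.mem_compl.1 hw (hS (by simpa using hvw))

lemma _root_.IsExtendable.isMatchable_univ {V : Type*} [Fintype V] [DecidableEq V]
    {G : SimpleGraph V} {k : ℕ} (h : IsExtendable G k) : G.IsMatchable Finset.univ := by
  obtain ⟨-, ⟨M, hM, hMk⟩, hext⟩ := h
  obtain ⟨P, hP, -⟩ := hext M hM hMk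
  exact hP.1.isMatchable (by simpa using hP.2.verts_eq_univ)

lemma _root_.IsExtendable.isWeaklyExtendable {V : Type*} [Fintype V] [DecidableEq V]
    {G : SimpleGraph V} {k : ℕ} (h : IsExtendable G k) (hk : 2 * k < Fintype.card V) :
    G.IsWeaklyExtendable k := by
  intro s hs hsk
  refine isMatchable_compl_of_card_le h.isMatchable_univ hk ?_ hs hsk
  clear hs hsk s
  intro s hs hsk
  obtain ⟨M, hM, hMs⟩ := hs.exists_isMatching
  have hc := hM.ncard_verts
  rw [hMs, Set.ncard_coe_finset] at hc
  obtain ⟨P, hP, hMP⟩ := h.2.2 M hM (by omega)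
  obtain ⟨f, hf⟩ := h.isMatchable_univ
  choose g hg using fun v => (hP.1 (hP.2 v)).exists
  have uniq : ∀ {a b c}, P.Adj a b → P.Adj a c → b = c := fun {a b c} hb hc =>
    (hP.1 (hP.2 a)).unique hb hc
  refine ⟨g, fun x hx => ⟨?_, uniq (hg _) (hg x).symm, P.adj_sub (hg x)⟩⟩
  rw [Finset.mem_compl] at hx ⊢
  intro hgs
  rw [← Finset.mem_coe, ← hMs] at hgs hx
  obtain ⟨y, hy, -⟩ := hM hgs
  have := uniq (hg x).symm (hMP.2 hy)
  rw [this] at hx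
  exact hx (M.edge_vert hy.symm)

lemma _root_.IsExtendable.of_isMatchable_compl {V : Type*} [Fintype V] [DecidableEq V]
    {G : SimpleGraph V} {k : ℕ} (hconn : G.Connected) {s : Finset V} (hs : G.IsMatchable s)
    (hsk : s.card = 2 * k) (h : ∀ S : Finset V, S.card = 2 * k → G.IsMatchable Sᶜ) :
    IsExtendable G k := by
  refine ⟨hconn, ?_, fun M hM hMk => ?_⟩
  · obtain ⟨M, hM, hMs⟩ := hs.exists_isMatching
    have hc := hM.ncard_verts
    rw [hMs, Set.ncard_coe_finset] at hc
    exact ⟨M, hM, by omega⟩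
  · classical
    have hc := hM.ncard_verts
    obtain ⟨N, hN, hNv⟩ := (h M.verts.toFinset (by
      rw [← Set.ncard_eq_toFinset_card']; omega)).exists_isMatching
    simp only [Finset.coe_compl, Set.coe_toFinset] at hNv
    refine ⟨M ⊔ N, ⟨hM.sup hN ?_, fun v => ?_⟩, le_sup_left⟩
    · rw [hM.support_eq_verts, hN.support_eq_verts, hNv]
      exact disjoint_compl_right
    · rw [Subgraph.verts_sup, hNv, Set.union_compl_self]
      trivial

/-- The lower bound on the number of edges of an extendable non-bipartite graph of small order. -/
theorem _root_.IsExtendable.le_ncard_edgeSet {V : Type*} [Fintype V] {G : SimpleGraph V} {k : ℕ}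
    (h : IsExtendable G k) (hcol : ¬ G.Colorable 2) (hk : 2 * k < Fintype.card V)
    (hcard : Fintype.card V + 2 ≤ 4 * k) :
    (2 * k + 1) * Fintype.card V / 2 ≤ G.edgeSet.ncard := by
  classical
  have hdeg : ∀ v, 2 * k + 1 ≤ G.degree v := lt_degree_of_isMatchable_compl hk fun S hS =>
    (h.isWeaklyExtendable hk).isMatchable_compl h.isMatchable_univ h.1 hcol hcard hS
  have h1 := Finset.card_nsmul_le_sum Finset.univ (fun v => G.degree v) _ fun v _ => hdeg v
  rw [sum_degrees_eq_twice_card_edges, Finset.card_univ, smul_eq_mul, mul_comm,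
    ← Set.ncard_coe_finset, coe_edgeFinset] at h1
  omega

section TwoCliques

/-- Two cliques on copies of `A`, where `a` in the first copy and `b` in the second one are joined
if `b - a ∈ E`. -/
def twoCliques {A : Type*} [AddCommGroup A] (E : Finset A) : SimpleGraph (A × Bool) where
  Adj x y := (x.2 = y.2 ∧ x.1 ≠ y.1) ∨ (x.2 = false ∧ y.2 = true ∧ y.1 - x.1 ∈ E) ∨
    (x.2 = true ∧ y.2 = false ∧ x.1 - y.1 ∈ E)
  symm := ⟨fun x y h => by
    rcases h with h | h | h
    · exact .inl ⟨h.1.symm, h.2.symm⟩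
    · exact .inr (.inr ⟨h.2.1, h.1, h.2.2⟩)
    · exact .inr (.inl ⟨h.2.1, h.1, h.2.2⟩)⟩
  loopless := ⟨fun x h => by
    rcases h with h | h | h
    · exact h.2 rfl
    · simp [h.1] at h
    · simp [h.1] at h⟩

lemma isMatchable_of_isClique {V : Type*} [DecidableEq V] {G : SimpleGraph V} {s : Finset V}
    (hs : G.IsClique s) (he : Even s.card) : G.IsMatchable s := by
  induction hn : s.card using Nat.strong_induction_on generalizing s with
  | _ n ih =>
    rcases s.eq_empty_or_nonempty with rfl | hne
    · exact isMatchable_empty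
    obtain ⟨i, hi⟩ := he
    have := hne.card_pos
    obtain ⟨x, hx, y, hy, hxy⟩ := Finset.one_lt_card.1 (by omega : 1 < s.card)
    have hc := card_erase_erase_add_two hx hy hxy
    have h := ih _ (by omega) (s := (s.erase x).erase y) (hs.subset (by
      intro a ha
      simp only [Finset.coe_erase, Set.mem_sdiff] at ha
      exact ha.1.1)) ⟨i - 1, by omega⟩ rfl
    clear ih
    convert h.insert_pair (hs hx hy hxy) (by simp) (by simp) using 1
    ext a
    simp only [Finset.mem_insert, Finset.mem_erase]
    by_cases hax : a = x
    · simp [hax, hx]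
    · by_cases hay : a = y
      · simp [hay, hy]
      · simp [hax, hay]

variable {A : Type*} [AddCommGroup A] {E : Finset A}

lemma twoCliques_adj_same {a b : A} {i : Bool} :
    (twoCliques E).Adj (a, i) (b, i) ↔ a ≠ b := by
  cases i <;> simp [twoCliques]

lemma twoCliques_adj_false_true {a b : A} :
    (twoCliques E).Adj (a, false) (b, true) ↔ b - a ∈ E := by
  simp [twoCliques]

lemma twoCliques_adj_true_false {a b : A} :
    (twoCliques E).Adj (a, true) (b, false) ↔ a - b ∈ E := by
  simp [twoCliques]

lemma twoCliques_connected (h0 : 0 ∈ E) : (twoCliques E).Connected := by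
  have h : ∀ a i, (twoCliques E).Reachable (0, false) (a, i) := by
    intro a i
    have h1 : (twoCliques E).Reachable (0, false) (a, false) := by
      by_cases ha : 0 = a
      · rw [← ha]
      · exact Adj.reachable (twoCliques_adj_same.2 ha)
    cases i
    · exact h1
    · exact h1.trans (Adj.reachable (twoCliques_adj_false_true.2 (by simpa using h0)))
  exact ⟨fun x y => (h x.1 x.2).symm.trans (h y.1 y.2)⟩

lemma twoCliques_not_colorable_two [Fintype A] (hA : 2 < Fintype.card A) :
    ¬ (twoCliques E).Colorable 2 := by
  rintro ⟨c⟩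
  obtain ⟨a, b, hab, h⟩ := Fintype.exists_ne_map_eq_of_card_lt (fun a : A => c (a, false))
    (by simpa using hA)
  exact c.valid (twoCliques_adj_same.2 hab) h

lemma twoCliques_degree [Fintype A] [DecidableEq A] [DecidableRel (twoCliques E).Adj]
    (x : A × Bool) : (twoCliques E).degree x + 1 = Fintype.card A + E.card := by
  obtain ⟨a, i⟩ := x
  have hd : ∀ f : A → A, Disjoint ((Finset.univ.erase a).image fun b => (b, i))
      (E.image fun b => (f b, !i)) := by
    intro f
    rw [Finset.disjoint_left]
    intro x hx hy
    obtain ⟨b, -, rfl⟩ := Finset.mem_image.1 hx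
    obtain ⟨c, -, h⟩ := Finset.mem_image.1 hy
    simp at h
  have hinj : ∀ i : Bool, Function.Injective fun b : A => (b, i) := by
    intro i b c h
    simpa using h
  have hcard : ∀ f : A → A, Function.Injective f →
      (((Finset.univ.erase a).image fun b => (b, i)) ∪ (E.image fun b => (f b, !i))).card + 1
        = Fintype.card A + E.card := by
    intro f hf
    have hA := Finset.card_erase_add_one (Finset.mem_univ a)
    rw [Finset.card_univ] at hA
    rw [Finset.card_union_of_disjoint (hd f), Finset.card_image_of_injective _ (hinj i),
      Finset.card_image_of_injective (f := fun b => (f b, !i)) _ ((hinj _).comp hf), ← hA]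
    omega
  cases i
  · rw [← hcard (a + ·) (add_right_injective a), ← card_neighborFinset_eq_degree]
    congr 2
    ext ⟨b, j⟩
    cases j
    · simp [twoCliques_adj_same, eq_comm]
    · simp only [mem_neighborFinset, twoCliques_adj_false_true]
      simp [← eq_sub_iff_add_eq']
  · rw [← hcard (a - ·) sub_right_injective, ← card_neighborFinset_eq_degree]
    congr 2
    ext ⟨b, j⟩
    cases j
    · simp only [mem_neighborFinset, twoCliques_adj_true_false]
      simp [sub_eq_iff_comm]
    · simp [twoCliques_adj_same, eq_comm]

variable {n : ℕ} [NeZero n]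

lemma min_le_card_translates {X : Finset (ZMod n)} (hX : X.Nonempty) (j : ℕ) :
    min n (X.card + j) ≤
      (Finset.univ.filter fun b : ZMod n => ∃ a ∈ X, ∃ i : ℕ, i ≤ j ∧ b = a + i).card := by
  induction j with
  | zero =>
    refine (min_le_right _ _).trans (Finset.card_le_card fun a ha => ?_)
    simpa using ha
  | succ j ih =>
    set Y : ℕ → Finset (ZMod n) := fun j =>
      Finset.univ.filter fun b : ZMod n => ∃ a ∈ X, ∃ i : ℕ, i ≤ j ∧ b = a + i with hY
    have hmem : ∀ j b, b ∈ Y j ↔ ∃ a ∈ X, ∃ i : ℕ, i ≤ j ∧ b = a + i := by simp [hY]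
    change _ ≤ (Y (j + 1)).card
    change _ ≤ (Y j).card at ih
    have hsub : Y j ⊆ Y (j + 1) := by
      intro b hb
      rw [hmem] at hb ⊢
      obtain ⟨a, ha, i, hi, rfl⟩ := hb
      exact ⟨a, ha, i, by omega, rfl⟩
    by_cases hcl : ∀ b ∈ Y j, b + 1 ∈ Y j
    · obtain ⟨a, ha⟩ := hX
      have ha' : a ∈ Y j := (hmem _ _).2 ⟨a, ha, 0, by omega, by simp⟩
      have hm : ∀ m : ℕ, a + m ∈ Y j := by
        intro m
        induction m with
        | zero => simpa using ha'
        | succ m ih' =>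
          push_cast
          rw [← add_assoc]
          exact hcl _ ih'
      have huniv : Y (j + 1) = Finset.univ := by
        refine Finset.eq_univ_of_forall fun c => hsub ?_
        have := hm (c - a).val
        simpa using this
      rw [huniv, Finset.card_univ, ZMod.card]
      exact min_le_left _ _
    · push Not at hcl
      obtain ⟨b, hb, hb'⟩ := hcl
      have : b + 1 ∈ Y (j + 1) := by
        rw [hmem] at hb ⊢
        obtain ⟨a, ha, i, hi, rfl⟩ := hb
        exact ⟨a, ha, i + 1, by omega, by push_cast; ring⟩
      have := Finset.card_lt_card (Finset.ssubset_iff_subset_ne.2 ⟨hsub, fun h => hb' (h ▸ this)⟩)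
      omega

lemma twoCliques_isMatchable {e : ℕ} (he : 1 ≤ e) {S : Finset (ZMod n × Bool)}
    (hS : Even S.card) (hn : n + 1 < S.card + e) :
    (twoCliques ((Finset.range e).image ((↑) : ℕ → ZMod n))).IsMatchable S := by
  set H := twoCliques ((Finset.range e).image ((↑) : ℕ → ZMod n)) with hH
  set X := Finset.univ.filter fun a : ZMod n => (a, false) ∈ S with hX
  set Y := Finset.univ.filter fun a : ZMod n => (a, true) ∈ S with hY
  have hcl : ∀ (Z : Finset (ZMod n)) i, Even Z.card →
      H.IsMatchable (Z.image fun a => (a, i)) := by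
    intro Z i hZ
    refine isMatchable_of_isClique ?_ ?_
    · intro x hx y hy hxy
      obtain ⟨a, -, rfl⟩ := Finset.mem_image.1 hx
      obtain ⟨b, -, rfl⟩ := Finset.mem_image.1 hy
      exact twoCliques_adj_same.2 fun h => hxy (by rw [h])
    · rwa [Finset.card_image_of_injective]
      intro b c h
      simpa using h
  have hdisj : ∀ Z Z' : Finset (ZMod n),
      Disjoint (Z.image fun a => (a, false)) (Z'.image fun a => (a, true)) := by
    intro Z Z'
    simp [Finset.disjoint_left]
  have hXY : S = (X.image fun a => (a, false)) ∪ (Y.image fun a => (a, true)) := by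
    ext ⟨a, i⟩
    cases i <;> simp [hX, hY]
  have hc : S.card = X.card + Y.card := by
    rw [hXY, Finset.card_union_of_disjoint (hdisj X Y), Finset.card_image_of_injective,
      Finset.card_image_of_injective]
    all_goals
      intro b c h
      simpa using h
  by_cases hXe : Even X.card
  · have hYe : Even Y.card := by
      rw [hc, Nat.even_add] at hS
      exact hS.1 hXe
    rw [hXY]
    exact (hcl X _ hXe).union (hcl Y _ hYe) (hdisj X Y)
  · have hYe : ¬ Even Y.card := by
      rw [hc, Nat.even_add] at hS
      exact fun h => hXe (hS.2 h)
    rw [Nat.not_even_iff_odd] at hXe hYe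
    obtain ⟨a, ha, b, hb, hab⟩ : ∃ a ∈ X, ∃ b ∈ Y, H.Adj (a, false) (b, true) := by
      by_contra! hcon
      have h1 := min_le_card_translates (Finset.card_pos.1 hXe.pos) (e - 1)
      have h2 := Finset.card_le_card (Finset.subset_univ
        ((Finset.univ.filter fun b : ZMod n => ∃ a ∈ X, ∃ i : ℕ, i ≤ e - 1 ∧ b = a + i) ∪ Y))
      rw [Finset.card_union_of_disjoint, Finset.card_univ, ZMod.card] at h2
      · have := hYe.pos
        omega
      · rw [Finset.disjoint_left]
        intro b hb hbY
        simp only [Finset.mem_filter, Finset.mem_univ, true_and] at hb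
        obtain ⟨a, ha, i, hi, rfl⟩ := hb
        refine hcon a ha _ hbY (twoCliques_adj_false_true.2 ?_)
        simp only [add_sub_cancel_left, Finset.mem_image, Finset.mem_range]
        exact ⟨i, by omega, rfl⟩
    have hXa := Finset.card_erase_add_one ha
    have hYb := Finset.card_erase_add_one hb
    have hX' : Even (X.erase a).card := by
      obtain ⟨i, hi⟩ := hXe
      exact ⟨i, by omega⟩
    have hY' : Even (Y.erase b).card := by
      obtain ⟨i, hi⟩ := hYe
      exact ⟨i, by omega⟩
    convert ((hcl _ false hX').union (hcl _ true hY') (hdisj _ _)).insert_pair hab (by simp)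
      (by simp) using 1
    rw [hXY]
    ext ⟨c, i⟩
    cases i
    · by_cases h : c = a
      · simp [h, ha]
      · simp [h]
    · by_cases h : c = b
      · simp [h, hb]
      · simp [h]

end TwoCliques

lemma IsMatchable.comap {V W : Type*} {H : SimpleGraph W} (φ : V ≃ W) {s : Finset V}
    (h : H.IsMatchable (s.map φ.toEmbedding)) : (H.comap φ).IsMatchable s := by
  obtain ⟨f, hf⟩ := h
  refine ⟨fun x => φ.symm (f (φ x)), fun x hx => ?_⟩
  obtain ⟨h1, h2, h3⟩ := hf (φ x) (by simpa using hx)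
  obtain ⟨y, hy, hyx⟩ := Finset.mem_map.1 h1
  refine ⟨?_, by simp [h2], by simpa using h3⟩
  beta_reduce
  rw [← hyx]
  simpa using hy

/-- The lower bound on the number of edges is attained. -/
theorem exists_isExtendable_ncard_edgeSet {k n : ℕ} (hkn : k < n) (hn : n + 1 ≤ 2 * k) :
    ∃ G : SimpleGraph (Fin (2 * n)), IsExtendable G k ∧ ¬ G.Colorable 2 ∧
      2 * G.edgeSet.ncard = (2 * k + 1) * (2 * n) := by
  classical
  have : NeZero n := ⟨by omega⟩
  set E : Finset (ZMod n) := (Finset.range (2 * k + 2 - n)).image (↑) with hE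
  have hEc : E.card = 2 * k + 2 - n := by
    rw [hE, Finset.card_image_of_injOn, Finset.card_range]
    intro a ha b hb hab
    simp only [Finset.coe_range, Set.mem_Iio] at ha hb
    have := (ZMod.natCast_eq_natCast_iff' a b n).1 hab
    rwa [Nat.mod_eq_of_lt (by omega), Nat.mod_eq_of_lt (by omega)] at this
  have h0 : (0 : ZMod n) ∈ E := Finset.mem_image.2 ⟨0, by simp; omega, by simp⟩
  have hcard : Fintype.card (ZMod n × Bool) = 2 * n := by
    simp [ZMod.card, mul_comm]
  let φ : Fin (2 * n) ≃ ZMod n × Bool := Fintype.equivOfCardEq (by simp [hcard])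
  let ψ : (twoCliques E).comap φ ≃g twoCliques E := ⟨φ, by simp⟩
  have hM : ∀ S : Finset (Fin (2 * n)), Even S.card → 2 * n ≤ S.card + 2 * k →
      ((twoCliques E).comap φ).IsMatchable S := fun S hS hc =>
    (twoCliques_isMatchable (by omega) (by simpa using hS) (by rw [Finset.card_map]; omega)).comap φ
  have huniv := hM Finset.univ (by simp) (by simp)
  obtain ⟨s, -, hs, hsk⟩ := huniv.exists_superset isMatchable_empty (m := k) (by simp)
    (by simp; omega)
  refine ⟨(twoCliques E).comap φ, .of_isMatchable_compl ?_ hs hsk fun S hS => hM _ ?_ ?_, ?_, ?_⟩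
  · exact ψ.connected_iff.2 (twoCliques_connected h0)
  · rw [Finset.card_compl, hS, Fintype.card_fin, ← Nat.mul_sub]
    exact even_two_mul _
  · rw [Finset.card_compl, hS, Fintype.card_fin]
    omega
  · intro h
    refine twoCliques_not_colorable_two (E := E) (by rw [ZMod.card]; omega) ?_
    exact h.of_hom ψ.symm.toHom
  · have h1 := (twoCliques E).sum_degrees_eq_twice_card_edges
    rw [← ψ.card_edgeFinset_eq, Finset.sum_congr rfl (g := fun _ => 2 * k + 1) fun x _ => by
      have := twoCliques_degree (E := E) x
      rw [ZMod.card] at this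
      omega] at h1
    rw [← coe_edgeFinset, Set.ncard_coe_finset, ← h1, Finset.sum_const, Finset.card_univ, hcard,
      smul_eq_mul, mul_comm]

end SimpleGraph

theorem eps_small_nu (k ν : ℕ) (hk : 2 ≤ k) (heven : Even ν)
    (h1 : 2 * k + 2 ≤ ν) (h2 : ν ≤ 4 * k - 2) :
    (∀ (V : Type) [Fintype V] (G : SimpleGraph V), Fintype.card V = ν →
      IsExtendable G k → ¬ G.Colorable 2 → (2 * k + 1) * ν / 2 ≤ G.edgeSet.ncard) ∧
    (∃ G : SimpleGraph (Fin ν), IsExtendable G k ∧ ¬ G.Colorable 2 ∧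
      G.edgeSet.ncard = (2 * k + 1) * ν / 2) := by
  refine ⟨fun V _ G hV hG hcol => ?_, ?_⟩
  · subst hV
    exact hG.le_ncard_edgeSet hcol (by omega) (by omega)
  · obtain ⟨n, rfl⟩ := heven
    obtain ⟨G, hG, hcol, hc⟩ := exists_isExtendable_ncard_edgeSet (k := k) (n := n) (by omega)
      (by omega)
    rw [← two_mul]
    exact ⟨G, hG, hcol, by omega⟩
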